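/- arXiv:1404.1325 — 3 statements merged into one kernel-verified Lean document; each statement's English description precedes it below -/
import Mathlib

section
/- Let A be an invertible real m×m matrix, b ∈ ℝ^m, let (d_t^DA)_{t≥1} and (w_t)_{t≥0} be arbitrary sequences in ℝ^m, and let π_0 ∈ ℝ^m be arbitrary. Define recursively, for t ≥ 1, the price π_t = π̄_{t−1} + A⁻¹(d̄_{t−1} − d_t^DA), where π̄_{t−1} = (1/t)∑_{i=0}^{t−1} π_i, d̄_{t−1} = (1/t)∑_{i=0}^{t−1} d_i, and d_i = b − A π_i + w_i for all i ≥ 0. Then for every t ≥ 1, b − A π_t − d_t^DA = −(1/t) ∑_{i=0}^{t−1} w_i. -/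
open Matrix Finset

theorem toEuclideanLin_toEuclideanLin_inv {m : ℕ} (A : Matrix (Fin m) (Fin m) ℝ)
    (hA : IsUnit A.det) (x : EuclideanSpace ℝ (Fin m)) :
    A.toEuclideanLin (A⁻¹.toEuclideanLin x) = x := by
  simp [Matrix.toLpLin_apply, Matrix.mulVec_mulVec, Matrix.mul_nonsing_inv A hA]

/-- for the known-`A` stochastic-approximation policy
`π_t = π̄_{t−1} + A⁻¹(d̄_{t−1} − d_t^DA)` with demands `d_i = b − Aπ_i + w_i`,
the pricing error satisfies `b − Aπ_t − d_t^DA = −(1/t)∑_{i=0}^{t−1} w_i` for all `t ≥ 1`. -/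
theorem stmt3 {m : ℕ} (A : Matrix (Fin m) (Fin m) ℝ) (hA : IsUnit A.det)
    (b : EuclideanSpace ℝ (Fin m))
    (dDA w π d : ℕ → EuclideanSpace ℝ (Fin m))
    (hd : ∀ i, d i = b - A.toEuclideanLin (π i) + w i)
    (hπ : ∀ t, 1 ≤ t →
      π t = ((t : ℝ)⁻¹ • ∑ i ∈ range t, π i)
        + A⁻¹.toEuclideanLin (((t : ℝ)⁻¹ • ∑ i ∈ range t, d i) - dDA t)) :
    ∀ t, 1 ≤ t →
      b - A.toEuclideanLin (π t) - dDA t = -((t : ℝ)⁻¹ • ∑ i ∈ range t, w i) := by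
  intro t ht
  have ht0 : (t : ℝ) ≠ 0 := by positivity
  have havg : (t : ℝ)⁻¹ • ∑ i ∈ range t, d i
      = b - (t : ℝ)⁻¹ • A.toEuclideanLin (∑ i ∈ range t, π i)
        + (t : ℝ)⁻¹ • ∑ i ∈ range t, w i := by
    simp only [hd, sum_add_distrib, sum_sub_distrib, sum_const, card_range, map_sum,
      smul_add, smul_sub, ← Nat.cast_smul_eq_nsmul ℝ, inv_smul_smul₀ ht0]
  rw [hπ t ht, map_add, toEuclideanLin_toEuclideanLin_inv A hA, map_smul, havg]
  abel
end

section
/- Let a ≥ 1, c ≥ 0, and n ≥ 1, and suppose that 1 − a/(i+1) + c/(i+1)² ≥ 0 for every integer i with 1 ≤ i ≤ n−1. Then ∏_{i=1}^{n−1} ( 1 − a/(i+1) + c/(i+1)² ) ≤ e^{a+c} / n. -/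
open Finset

lemma prod_one_sub_div_add_div_sq_le_exp {a c : ℝ} (ha : 0 ≤ a) (hc : 0 ≤ c) (m : ℕ)
    (hpos : ∀ i : ℕ, 1 ≤ i → i ≤ m → 0 ≤ 1 - a / (i + 1) + c / ((i : ℝ) + 1) ^ 2) :
    ∏ i ∈ Icc 1 m, (1 - a / ((i : ℝ) + 1) + c / ((i : ℝ) + 1) ^ 2)
      ≤ Real.exp (a * (Real.log 2 - Real.log (m + 2)) + c * (1 - 1 / (m + 1))) := by
  induction m with
  | zero => simp
  | succ m ih =>
    have hfac := hpos (m + 1) (by omega) le_rfl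
    rw [prod_Icc_succ_top (by omega)]
    refine (mul_le_mul (ih fun i h₁ h₂ => hpos i h₁ (by omega))
      (?_ : _ ≤ Real.exp (-(a / (((m + 1 : ℕ) : ℝ) + 1)) + c / (((m + 1 : ℕ) : ℝ) + 1) ^ 2))
      hfac (Real.exp_nonneg _)).trans ?_
    · refine le_trans (le_of_eq ?_) (Real.add_one_le_exp _)
      ring
    rw [← Real.exp_add, Real.exp_le_exp]
    push_cast
    have hm : (0 : ℝ) ≤ m := m.cast_nonneg
    have hlog : Real.log (m + 1 + 2) - Real.log (m + 2) ≤ 1 / ((m : ℝ) + 1 + 1) := by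
      rw [← Real.log_div (by positivity) (by positivity)]
      refine (Real.log_le_sub_one_of_pos (by positivity)).trans (le_of_eq ?_)
      field_simp
      ring
    have hsq : 1 / ((m : ℝ) + 1 + 1) ^ 2 ≤ 1 / (m + 1) - 1 / (m + 1 + 1) := by
      rw [div_sub_div _ _ (by positivity) (by positivity),
        div_le_div_iff₀ (by positivity) (by positivity)]
      nlinarith
    have h₁ := mul_le_mul_of_nonneg_left hlog ha
    have h₂ := mul_le_mul_of_nonneg_left hsq hc
    rw [mul_one_div] at h₁ h₂
    linarith

/-- if `a ≥ 1`, `c ≥ 0`, `n ≥ 1` and all factors are nonnegative, then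
`∏_{i=1}^{n−1} (1 − a/(i+1) + c/(i+1)²) ≤ e^{a+c}/n`. -/
theorem stmt9 (a c : ℝ) (ha : 1 ≤ a) (hc : 0 ≤ c) (n : ℕ) (hn : 1 ≤ n)
    (hpos : ∀ i : ℕ, 1 ≤ i → i ≤ n - 1 →
      0 ≤ 1 - a / (i + 1) + c / ((i : ℝ) + 1) ^ 2) :
    ∏ i ∈ Icc 1 (n - 1), (1 - a / ((i : ℝ) + 1) + c / ((i : ℝ) + 1) ^ 2)
      ≤ Real.exp (a + c) / n := by
  have hn' : (0 : ℝ) < n := by exact_mod_cast hn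
  refine (prod_one_sub_div_add_div_sq_le_exp (by linarith) hc (n - 1) hpos).trans ?_
  have hexp : Real.exp (a + c) / n = Real.exp (a + c - Real.log n) := by
    rw [Real.exp_sub, Real.exp_log hn']
  rw [hexp, Real.exp_le_exp, Nat.cast_sub hn, Nat.cast_one, sub_add_cancel]
  have hlog : Real.log n ≤ Real.log (n - 1 + 2) := Real.log_le_log hn' (by linarith)
  have hlog_nonneg : 0 ≤ Real.log n := Real.log_natCast_nonneg n
  have hlog_two : Real.log 2 ≤ 1 := by linarith [Real.log_two_lt_d9]
  have hdiv : 0 ≤ c * (1 / n) := by positivity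
  nlinarith
end

section
/- Let a ≥ 0, c ≥ 0, and let j, n be integers with 0 ≤ j ≤ n−1, and suppose that 1 − a/(i+1) + c/(i+1)² ≥ 0 for every integer i with j+1 ≤ i ≤ n−1. Then ∏_{i=j+1}^{n−1} ( 1 − a/(i+1) + c/(i+1)² ) ≤ e^{c} · ( (j+2)/(n+1) )^{a}. -/
open Finset

lemma one_sub_div_add_div_sq_le {a c x : ℝ} (ha : 0 ≤ a) (hc : 0 ≤ c) (hx : 0 < x) :
    1 - a / (x + 1) + c / (x + 1) ^ 2
      ≤ Real.exp (c * (1 / x - 1 / (x + 1))) * ((x + 1) / (x + 2)) ^ a := by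
  have hq : 0 < (x + 1) / (x + 2) := by positivity
  have hlog : -(1 / (x + 1)) ≤ Real.log ((x + 1) / (x + 2)) := by
    have h := Real.one_sub_inv_le_log_of_pos hq
    have e : 1 - ((x + 1) / (x + 2))⁻¹ = -(1 / (x + 1)) := by
      field_simp
      ring
    rwa [e] at h
  have hsq : 1 / (x + 1) ^ 2 ≤ 1 / x - 1 / (x + 1) := by
    have e : 1 / x - 1 / (x + 1) = 1 / (x * (x + 1)) := by
      field_simp
      ring
    rw [e]
    exact one_div_le_one_div_of_le (by positivity) (by nlinarith)
  rw [Real.rpow_def_of_pos hq, ← Real.exp_add]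
  have h₁ := mul_le_mul_of_nonneg_left hlog ha
  have h₂ := mul_le_mul_of_nonneg_left hsq hc
  have e₁ : a * -(1 / (x + 1)) = -(a / (x + 1)) := by ring
  have e₂ : c * (1 / (x + 1) ^ 2) = c / (x + 1) ^ 2 := by ring
  refine le_trans ?_ (Real.add_one_le_exp _)
  linarith

lemma prod_Icc_one_sub_div_add_div_sq_le {a c : ℝ} (ha : 0 ≤ a) (hc : 0 ≤ c) {j m : ℕ}
    (hjm : j ≤ m)
    (hpos : ∀ i : ℕ, j + 1 ≤ i → i ≤ m → 0 ≤ 1 - a / ((i : ℝ) + 1) + c / ((i : ℝ) + 1) ^ 2) :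
    ∏ i ∈ Icc (j + 1) m, (1 - a / ((i : ℝ) + 1) + c / ((i : ℝ) + 1) ^ 2)
      ≤ Real.exp (c * (1 / ((j : ℝ) + 1) - 1 / ((m : ℝ) + 1)))
        * (((j : ℝ) + 2) / ((m : ℝ) + 2)) ^ a := by
  induction m, hjm using Nat.le_induction with
  | base =>
    have h : ((j : ℝ) + 2) ≠ 0 := by positivity
    simp [div_self h]
  | succ m hjm ih =>
    rw [prod_Icc_succ_top (by omega)]
    have hf := one_sub_div_add_div_sq_le ha hc (x := (m : ℝ) + 1) (by positivity)
    have h := mul_le_mul (ih fun i h₁ h₂ => hpos i h₁ (by omega)) (by push_cast; exact hf)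
      (hpos (m + 1) (by omega) le_rfl) (by positivity)
    refine h.trans_eq ?_
    rw [mul_mul_mul_comm, ← Real.exp_add, ← Real.mul_rpow (by positivity) (by positivity)]
    push_cast
    congr 2
    · ring
    · field_simp
      ring

/-- if `a ≥ 0`, `c ≥ 0`, `0 ≤ j ≤ n−1` and all factors are nonnegative, then
`∏_{i=j+1}^{n−1} (1 − a/(i+1) + c/(i+1)²) ≤ e^c · ((j+2)/(n+1))^a`. -/
theorem stmt10 (a c : ℝ) (ha : 0 ≤ a) (hc : 0 ≤ c) (j n : ℕ) (hjn : j ≤ n - 1)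
    (hn : 1 ≤ n)
    (hpos : ∀ i : ℕ, j + 1 ≤ i → i ≤ n - 1 →
      0 ≤ 1 - a / (i + 1) + c / ((i : ℝ) + 1) ^ 2) :
    ∏ i ∈ Icc (j + 1) (n - 1), (1 - a / ((i : ℝ) + 1) + c / ((i : ℝ) + 1) ^ 2)
      ≤ Real.exp c * (((j : ℝ) + 2) / ((n : ℝ) + 1)) ^ a := by
  refine (prod_Icc_one_sub_div_add_div_sq_le ha hc hjn hpos).trans ?_
  have hcast : ((n - 1 : ℕ) : ℝ) + 2 = (n : ℝ) + 1 := by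
    rw [Nat.cast_sub hn]
    push_cast
    ring
  rw [hcast]
  gcongr
  refine mul_le_of_le_one_right hc ?_
  have h₁ : 1 / ((j : ℝ) + 1) ≤ 1 :=
    div_le_one_of_le₀ (by linarith [j.cast_nonneg (α := ℝ)]) (by positivity)
  have h₂ : 0 ≤ 1 / (((n - 1 : ℕ) : ℝ) + 1) := by positivity
  linarith
end
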